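/- Let A_M be an Artin group of finite type, so that (A_M, A_M^+) is a lattice ordered group. Suppose {V_s : s ∈ Λ} is a collection of isometries on a Hilbert space H satisfying the Artin relations ⟨V_s V_t⟩^{m_{s,t}} = ⟨V_t V_s⟩^{m_{s,t}} for all s, t ∈ Λ. Then the map s ↦ V_s extends to an isometric representation V of the Artin monoid A_M^+ on H, and if moreover V_s V_s* V_t V_t* = V_{s∨t} V_{s∨t}* for all generators s, t ∈ Λ, then V is a covariant isometric representation of A_M^+, i.e. V_x V_x* V_y V_y* = V_{x∨y} V_{x∨y}* for all x, y ∈ A_M^+ (with the convention V_∞ = 0). -/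

import Mathlib

section Order

variable {H : Type*} [Group H]

/-- `x ≤ y` in the left-invariant partial order determined by the cone `P`. -/
def lle (P : Submonoid H) (x y : H) : Prop := x⁻¹ * y ∈ P

/-- `x ≤ᵣ y` in the right-invariant partial order determined by the cone `P`. -/
def rle (P : Submonoid H) (x y : H) : Prop := y * x⁻¹ ∈ P

/-- `x` and `y` have a common upper bound for the left-invariant order. -/
def HasUB (P : Submonoid H) (x y : H) : Prop := ∃ z, lle P x z ∧ lle P y z

/-- `m` is a least upper bound of `x` and `y` for the left-invariant order. -/
def IsLub' (P : Submonoid H) (x y m : H) : Prop :=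
  lle P x m ∧ lle P y m ∧ ∀ w, lle P x w → lle P y w → lle P m w

/-- `w` is a greatest lower bound of `u` and `v` for the right-invariant order
(greatest among *all* common right lower bounds in the group). -/
def IsRGlb (P : Submonoid H) (u v w : H) : Prop :=
  rle P w u ∧ rle P w v ∧ ∀ z, rle P z u → rle P z v → rle P z w

/-- `(H,P)` is a partially ordered group: `P ∩ P⁻¹ = {1}`. -/
def IsPoGroup (P : Submonoid H) : Prop := ∀ x : H, x ∈ P → x⁻¹ ∈ P → x = 1

/-- `(H,P)` is a quasi-lattice ordered group: it is a partially ordered group in which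
every pair of elements with a common upper bound has a least upper bound. -/
def IsQLO (P : Submonoid H) : Prop :=
  IsPoGroup P ∧ ∀ x y : H, HasUB P x y → ∃ m, IsLub' P x y m

end Order

section Rep

variable {E : Type*} [NormedAddCommGroup E] [InnerProductSpace ℂ E] [CompleteSpace E]
variable {H : Type*} [Group H]

/-- `V` is an isometric representation of the submonoid `P` on the Hilbert space `E`:
a unital multiplicative map whose values are isometries. -/
def IsIsomRep (P : Submonoid H) (V : ↥P → (E →L[ℂ] E)) : Prop :=
  V 1 = 1 ∧ (∀ x y : ↥P, V (x * y) = V x * V y) ∧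
    ∀ x : ↥P, ContinuousLinearMap.adjoint (V x) * V x = 1

/-- `V` is covariant (in Nica's sense) for the quasi-lattice order with cone `P`:
`V_x V_x^* V_y V_y^* = V_{x ∨ y} V_{x ∨ y}^*`, with the convention `V_∞ = 0`. -/
def IsCovariantRep (P : Submonoid H) (V : ↥P → (E →L[ℂ] E)) : Prop :=
  ∀ x y : ↥P,
    (¬ HasUB P (x : H) (y : H) →
      V x * ContinuousLinearMap.adjoint (V x) *
        (V y * ContinuousLinearMap.adjoint (V y)) = 0) ∧
    ∀ m : ↥P, IsLub' P (x : H) (y : H) (m : H) →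
      V x * ContinuousLinearMap.adjoint (V x) *
        (V y * ContinuousLinearMap.adjoint (V y)) =
        V m * ContinuousLinearMap.adjoint (V m)

end Rep

variable {Λ : Type*}

/-- The alternating word `⟨st⟩^m = sts⋯` of length `m` in the free group. -/
def altWord (s t : Λ) : ℕ → FreeGroup Λ
  | 0 => 1
  | n + 1 => FreeGroup.of s * altWord t s n

/-- `M` is a Coxeter matrix: symmetric, `1` on the diagonal, and at least `2`
off the diagonal (`∞` being allowed, as the value `⊤` of `ℕ∞`). -/
def IsCoxeterMatrix (M : Λ → Λ → ℕ∞) : Prop :=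
  (∀ s t, M s t = M t s) ∧ (∀ s, M s s = 1) ∧ ∀ s t, s ≠ t → 2 ≤ M s t

/-- The Artin relators of the Coxeter matrix `M`: `⟨st⟩^{m_{s,t}} (⟨ts⟩^{m_{s,t}})⁻¹`
for `m_{s,t} ≠ ∞` (relations with `m_{s,t} = ∞` are vacuous). -/
def ArtinRels (M : Λ → Λ → ℕ∞) : Set (FreeGroup Λ) :=
  {r | ∃ (s t : Λ) (m : ℕ), s ≠ t ∧ M s t = (m : ℕ∞) ∧
    r = altWord s t m * (altWord t s m)⁻¹}

/-- The Artin group of the Coxeter matrix `M`. -/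
def ArtinGroup (M : Λ → Λ → ℕ∞) : Type _ := PresentedGroup (ArtinRels M)

instance (M : Λ → Λ → ℕ∞) : Group (ArtinGroup M) :=
  inferInstanceAs (Group (PresentedGroup _))

/-- The Coxeter group of the Coxeter matrix `M`: the quotient of the Artin group
obtained by adding the relations `s² = 1`. -/
def CoxeterGroupOf (M : Λ → Λ → ℕ∞) : Type _ :=
  PresentedGroup (ArtinRels M ∪ {r | ∃ s : Λ, r = FreeGroup.of s * FreeGroup.of s})

instance (M : Λ → Λ → ℕ∞) : Group (CoxeterGroupOf M) :=
  inferInstanceAs (Group (PresentedGroup _))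

/-- The positive cone `A_M^+` of the Artin group: the submonoid generated by the
generators.  (For `A_M` of finite type the Artin monoid embeds in `A_M` with this
submonoid as its image, by Brieskorn–Saito and Deligne.) -/
def artinCone (M : Λ → Λ → ℕ∞) : Submonoid (ArtinGroup M) :=
  Submonoid.closure (Set.range fun s : Λ => (PresentedGroup.of s : ArtinGroup M))

/-- The generator `s`, as an element of the positive cone `A_M^+`. -/
def artinGen (M : Λ → Λ → ℕ∞) (s : Λ) : ↥(artinCone M) :=
  ⟨PresentedGroup.of s, Submonoid.subset_closure ⟨s, rfl⟩⟩

/-- The alternating product `⟨V_s V_t⟩^m = V_s V_t V_s ⋯` of length `m`. -/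
def altOp {E : Type*} [NormedAddCommGroup E] [InnerProductSpace ℂ E] [CompleteSpace E]
    (Vs : Λ → (E →L[ℂ] E)) (s t : Λ) : ℕ → (E →L[ℂ] E)
  | 0 => 1
  | n + 1 => Vs s * altOp Vs t s n

theorem Function.End.mul_apply' {α : Type*} (f g : Function.End α) (x : α) :
    (f * g) x = f (g x) := rfl

theorem Function.End.one_apply' {α : Type*} (x : α) : (1 : Function.End α) x = x := rfl

namespace CoxeterSystem

variable {B W : Type*} [Group W] {M : CoxeterMatrix B} (cs : CoxeterSystem M W)

open Classical in
/-- The action of a simple reflection on `W × ZMod 2` that conjugates the first coordinate and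
flips the second one exactly at the simple reflection itself. -/
noncomputable def parityStep (i : B) : Function.End (W × ZMod 2) :=
  fun p => (cs.simple i * p.1 * cs.simple i, p.2 + if p.1 = cs.simple i then 1 else 0)

open Classical in
theorem parityStep_mul_pow (i j : B) (n : ℕ) (p : W × ZMod 2) :
    ((cs.parityStep i * cs.parityStep j) ^ n) p =
      ((cs.simple i * cs.simple j) ^ n * p.1 * ((cs.simple i * cs.simple j) ^ n)⁻¹,
        p.2 + ∑ k ∈ Finset.range (2 * n),
          if p.1 = cs.simple j * (cs.simple i * cs.simple j) ^ k then 1 else 0) := by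
  have key : ∀ k : ℕ, (cs.simple i * cs.simple j) ^ k * cs.simple j *
      (cs.simple i * cs.simple j) ^ k = cs.simple j := by
    intro k
    induction k with
    | zero => simp
    | succ k ih =>
      rw [pow_succ (cs.simple i * cs.simple j) k]
      nth_rw 2 [← pow_succ]
      rw [pow_succ']
      calc _ = (cs.simple i * cs.simple j) ^ k * (cs.simple i * cs.simple j * cs.simple j *
            cs.simple i * cs.simple j) * (cs.simple i * cs.simple j) ^ k := by
              simp only [mul_assoc]
        _ = _ := by
          rw [cs.simple_mul_simple_cancel_right, cs.simple_mul_simple_self, one_mul, ih]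
  induction n with
  | zero => simp; rfl
  | succ n ih =>
    rw [pow_succ', Function.End.mul_apply', ih]
    have key' : cs.simple j * (cs.simple i * cs.simple j) ^ n =
        (cs.simple i * cs.simple j) ^ n *
          (cs.simple j * (cs.simple i * cs.simple j) ^ (2 * n)) := by
      nth_rw 1 [← key n]
      simp only [two_mul, pow_add, mul_assoc]
    have e1 : (cs.simple i * cs.simple j) ^ n * p.1 * ((cs.simple i * cs.simple j) ^ n)⁻¹
        = cs.simple j ↔ p.1 = cs.simple j * (cs.simple i * cs.simple j) ^ (2 * n) := by
      rw [mul_inv_eq_iff_eq_mul, key', mul_right_inj]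
    have e2 : cs.simple j * ((cs.simple i * cs.simple j) ^ n * p.1 *
        ((cs.simple i * cs.simple j) ^ n)⁻¹) * cs.simple j
        = cs.simple i ↔ p.1 = cs.simple j * (cs.simple i * cs.simple j) ^ (2 * n + 1) := by
      have : cs.simple i = cs.simple j * (cs.simple j * (cs.simple i * cs.simple j)) *
          cs.simple j := by
        simp [mul_assoc]
      nth_rw 3 [this]
      rw [mul_left_inj, mul_right_inj, mul_inv_eq_iff_eq_mul, mul_assoc (cs.simple j), ← pow_succ',
        pow_succ, ← mul_assoc, key', mul_assoc, mul_right_inj, mul_assoc, ← pow_succ]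
    simp only [parityStep, Function.End.mul_apply', e1, e2]
    ext
    · simp only [pow_succ', mul_inv_rev, inv_simple, mul_assoc]
    · rw [show 2 * (n + 1) = 2 * n + 1 + 1 by ring, Finset.sum_range_succ, Finset.sum_range_succ]
      simp only [add_assoc]

theorem isLiftable_parityStep : M.IsLiftable cs.parityStep := by
  classical
  intro i j
  funext p
  rw [parityStep_mul_pow, cs.simple_mul_simple_pow, two_mul, Finset.sum_range_add]
  simp only [pow_add, cs.simple_mul_simple_pow, one_mul]
  rw [CharTwo.add_self_eq_zero]
  simp [Function.End.one_apply']

open Classical in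
theorem lift_parityStep_wordProd (ω : List B) (p : W × ZMod 2) :
    cs.lift ⟨_, cs.isLiftable_parityStep⟩ (cs.wordProd ω) p =
      (cs.wordProd ω * p.1 * (cs.wordProd ω)⁻¹, p.2 + ((cs.rightInvSeq ω).count p.1 : ZMod 2)) := by
  induction ω with
  | nil => simp; rfl
  | cons i ω ih =>
    rw [cs.wordProd_cons, map_mul, cs.lift_apply_simple, Function.End.mul_apply', ih,
      rightInvSeq, List.count_cons]
    have : (cs.wordProd ω * p.1 * (cs.wordProd ω)⁻¹ = cs.simple i) ↔
        ((cs.wordProd ω)⁻¹ * cs.simple i * cs.wordProd ω = p.1) := by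
      constructor
      · intro h; rw [← h]; group
      · intro h; rw [← h]; group
    simp only [parityStep, this, beq_iff_eq]
    ext
    · simp [mul_assoc]
    · simp only [add_assoc, Nat.cast_add, Nat.cast_ite, Nat.cast_one, Nat.cast_zero]

open Classical in
theorem count_rightInvSeq_eq {ω ω' : List B} (h : cs.wordProd ω = cs.wordProd ω') (t : W) :
    ((cs.rightInvSeq ω).count t : ZMod 2) = (cs.rightInvSeq ω').count t := by
  have h1 := cs.lift_parityStep_wordProd ω (t, 0)
  rw [h, cs.lift_parityStep_wordProd ω' (t, 0)] at h1
  simpa using (congrArg Prod.snd h1).symm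

/-- The exchange property on the right. -/
theorem exists_eraseIdx_of_isRightDescent {ω : List B} {i : B}
    (h : cs.IsRightDescent (cs.wordProd ω) i) :
    ∃ k < ω.length, cs.wordProd ω * cs.simple i = cs.wordProd (ω.eraseIdx k) := by
  classical
  obtain ⟨η, hη, hw⟩ := cs.exists_isReduced (cs.wordProd ω * cs.simple i)
  have hprod : cs.wordProd (η.concat i) = cs.wordProd ω := by
    rw [cs.wordProd_concat, ← hw, cs.simple_mul_simple_cancel_right]
  have hred : cs.IsReduced (η.concat i) := by
    unfold IsReduced at hη ⊢
    rw [hprod, List.length_concat, ← hη, ← hw]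
    exact ((cs.isRightDescent_iff).1 h).symm
  have hcount : (cs.rightInvSeq (η.concat i)).count (cs.simple i) = 1 := by
    apply List.count_eq_one_of_mem hred.nodup_rightInvSeq
    rw [rightInvSeq_concat]; simp
  have h2 := cs.count_rightInvSeq_eq hprod (cs.simple i)
  rw [hcount] at h2
  have hmem : cs.simple i ∈ cs.rightInvSeq ω := by
    by_contra hc
    rw [List.count_eq_zero_of_not_mem hc] at h2
    simp at h2
  obtain ⟨k, hk, hki⟩ := List.getElem_of_mem hmem
  have hk' : k < ω.length := by simpa using hk
  refine ⟨k, hk', ?_⟩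
  rw [← cs.wordProd_mul_getD_rightInvSeq, List.getD_eq_getElem _ _ hk, hki]

/-- The exchange property on the left. -/
theorem exists_eraseIdx_of_isLeftDescent {ω : List B} {i : B}
    (h : cs.IsLeftDescent (cs.wordProd ω) i) :
    ∃ k < ω.length, cs.simple i * cs.wordProd ω = cs.wordProd (ω.eraseIdx k) := by
  rw [← cs.isRightDescent_inv_iff, ← cs.wordProd_reverse] at h
  obtain ⟨k, hk, hki⟩ := cs.exists_eraseIdx_of_isRightDescent h
  rw [List.length_reverse] at hk
  refine ⟨ω.length - 1 - k, by omega, ?_⟩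
  have h3 := congrArg (·⁻¹) hki
  simp only [mul_inv_rev, ← cs.wordProd_reverse, List.reverse_reverse, inv_simple] at h3
  rw [h3, List.eraseIdx_eq_take_drop_succ, List.eraseIdx_eq_take_drop_succ, List.reverse_append,
    List.reverse_drop, List.reverse_take]
  simp only [List.reverse_reverse, List.length_reverse]
  congr 3 <;> omega

end CoxeterSystem

namespace CoxeterMatrix

open Polynomial.Chebyshev Real

variable {B : Type*} (M : CoxeterMatrix B)

/-- The coroot of `i` in the geometric representation: `e_j ↦ -2 cos (π / m_{i,j})`. -/
noncomputable def coroot (i : B) : Module.Dual ℝ (B →₀ ℝ) :=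
  Finsupp.lsum ℝ fun j => (-2 * cos (π / M i j)) • LinearMap.id

theorem coroot_single (i j : B) : M.coroot i (Finsupp.single j 1) = -2 * cos (π / M i j) := by
  simp [coroot]

theorem coroot_self (i : B) : M.coroot i (Finsupp.single i 1) = 2 := by
  simp [coroot_single]

/-- The simple reflections of the geometric representation. -/
noncomputable def geomReflection (i : B) : (B →₀ ℝ) ≃ₗ[ℝ] (B →₀ ℝ) :=
  Module.reflection (M.coroot_self i)

theorem geomReflection_apply (i : B) (z : B →₀ ℝ) :
    M.geomReflection i z = z - M.coroot i z • Finsupp.single i 1 :=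
  Module.reflection_apply _ (M.coroot_self i)

theorem S_two_mul_cos_eq {θ : ℝ} (h : sin θ ≠ 0) (n : ℤ) :
    (S ℝ n).eval (2 * cos θ) = sin ((n + 1) * θ) / sin θ := by
  rw [← S_two_mul_real_cos, mul_div_cancel_right₀ _ h]

theorem sin_two_pi_div_ne_zero {m : ℕ} (hm : 3 ≤ m) : sin (2 * π / m) ≠ 0 := by
  have hm' : (3 : ℝ) ≤ m := by exact_mod_cast hm
  apply ne_of_gt
  apply sin_pos_of_pos_of_lt_pi
  · positivity
  · rw [div_lt_iff₀ (by positivity)]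
    nlinarith [pi_pos]

theorem coroot_mul_coroot_sub_two (i j : B) :
    M.coroot i (Finsupp.single j 1) * M.coroot j (Finsupp.single i 1) - 2 =
      2 * cos (2 * π / M i j) := by
  rw [coroot_single, coroot_single, M.symmetric j i, mul_div_assoc, cos_two_mul]
  ring

theorem S_eval_mul_add_eq_zero {m : ℕ} (hm : 3 ≤ m) :
    (S ℝ ((m - 2) / 2)).eval (2 * cos (2 * π / m)) * ((S ℝ ((m - 1) / 2)).eval (2 * cos (2 * π / m))
        + (S ℝ ((m - 3) / 2)).eval (2 * cos (2 * π / m))) = 0 ∧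
    (S ℝ ((m - 1) / 2)).eval (2 * cos (2 * π / m)) * ((S ℝ (m / 2)).eval (2 * cos (2 * π / m))
        + (S ℝ ((m - 2) / 2)).eval (2 * cos (2 * π / m))) = 0 := by
  have hs := sin_two_pi_div_ne_zero hm
  have hm0 : (m : ℝ) ≠ 0 := by
    have : m ≠ 0 := by omega
    exact_mod_cast this
  obtain ⟨k, rfl | rfl⟩ := m.even_or_odd'
  · have e1 : (((2 * k : ℕ) : ℤ) - 2) / 2 = k - 1 := by omega
    have e2 : (((2 * k : ℕ) : ℤ) - 1) / 2 = k - 1 := by omega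
    have h0 : (S ℝ ((k : ℤ) - 1)).eval (2 * cos (2 * π / (2 * k : ℕ))) = 0 := by
      rw [S_two_mul_cos_eq hs, div_eq_zero_iff]
      left
      rw [← sin_pi]
      congr 1
      have hk : (k : ℝ) ≠ 0 := by
        rintro hk
        simp [hk] at hm0
      push_cast
      field_simp
      ring
    rw [e1, e2, h0, zero_mul, zero_mul]
    exact ⟨rfl, rfl⟩
  · have e1 : (((2 * k + 1 : ℕ) : ℤ) - 2) / 2 = k - 1 := by omega
    have e2 : (((2 * k + 1 : ℕ) : ℤ) - 1) / 2 = k := by omega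
    have e3 : (((2 * k + 1 : ℕ) : ℤ) - 3) / 2 = k - 1 := by omega
    have e4 : ((2 * k + 1 : ℕ) : ℤ) / 2 = k := by omega
    have h0 : (S ℝ (k : ℤ)).eval (2 * cos (2 * π / (2 * k + 1 : ℕ))) +
        (S ℝ ((k : ℤ) - 1)).eval (2 * cos (2 * π / (2 * k + 1 : ℕ))) = 0 := by
      rw [S_two_mul_cos_eq hs, S_two_mul_cos_eq hs, ← add_div, div_eq_zero_iff]
      left
      have : (((k : ℤ) : ℝ) + 1) * (2 * π / (2 * k + 1 : ℕ)) =
          2 * π - ((((k : ℤ) - 1 : ℤ) : ℝ) + 1) * (2 * π / (2 * k + 1 : ℕ)) := by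
        push_cast at hm0 ⊢
        field_simp
        ring
      rw [this, sin_two_pi_sub, neg_add_cancel]
    rw [e1, e2, e3, e4, h0, mul_zero, mul_zero]
    exact ⟨rfl, rfl⟩

theorem isLiftable_geomReflection : M.IsLiftable M.geomReflection := by
  intro i j
  by_cases hij : i = j
  · subst hij
    rw [M.diagonal, pow_one]
    refine LinearEquiv.ext fun z => ?_
    exact Module.involutive_reflection (M.coroot_self i) z
  have h1 := M.off_diagonal i j hij
  rcases Nat.lt_or_ge (M i j) 3 with h | h
  · obtain h0 | h2 : M i j = 0 ∨ M i j = 2 := by omega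
    · rw [h0, pow_zero]
    · have e1 : M.coroot i (Finsupp.single j 1) = 0 := by
        rw [coroot_single, h2]; simp
      have e2 : M.coroot j (Finsupp.single i 1) = 0 := by
        rw [coroot_single, M.symmetric j i, h2]; simp
      rw [h2, pow_two]
      refine LinearEquiv.ext fun z => ?_
      change M.geomReflection i (M.geomReflection j (M.geomReflection i
        (M.geomReflection j z))) = z
      simp only [geomReflection_apply, map_sub, map_smul, e1, e2, coroot_self]
      module
  · refine LinearEquiv.ext fun z => ?_
    rw [geomReflection, geomReflection, Module.reflection_mul_reflection_pow_apply _ _ _ _ _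
      (M.coroot_mul_coroot_sub_two i j).symm, (S_eval_mul_add_eq_zero h).1,
      (S_eval_mul_add_eq_zero h).2, zero_smul, zero_smul, add_zero, add_zero]
    rfl

theorem dvd_of_geomReflection_pow {i j : B} (hij : i ≠ j) {q : ℕ}
    (h : (M.geomReflection i * M.geomReflection j) ^ q = 1) : M i j ∣ q := by
  have h1 := M.off_diagonal i j hij
  have hx := congrArg (fun g : (B →₀ ℝ) ≃ₗ[ℝ] (B →₀ ℝ) => g (Finsupp.single i 1)) h
  simp only [geomReflection, Module.reflection_mul_reflection_pow_apply_self _ _ _ _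
      (M.coroot_mul_coroot_sub_two i j).symm] at hx
  have hxi := DFunLike.congr_fun hx i
  have hxj := DFunLike.congr_fun hx j
  simp [hij, hij.symm, Ne.symm, coroot_single] at hxi hxj
  rcases Nat.lt_or_ge (M i j) 3 with h3 | h3
  · obtain h0 | h2 : M i j = 0 ∨ M i j = 2 := by omega
    · rw [M.symmetric j i, h0] at hxj
      simp [S_eval_two] at hxj
      simp [hxj]
    · rw [h2] at hxi ⊢
      have : 2 * cos (2 * π / (2 : ℕ)) = -2 := by
        rw [Nat.cast_ofNat, mul_div_cancel_left₀ _ two_ne_zero, cos_pi]; norm_num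
      rw [this, S_eval_neg_two, S_eval_neg_two, Int.negOnePow_sub, Int.negOnePow_one] at hxi
      rw [← even_iff_two_dvd]
      by_contra hodd
      rw [Nat.not_even_iff_odd] at hodd
      rw [Int.negOnePow_odd _ (by exact_mod_cast hodd)] at hxi
      push_cast at hxi
      norm_num at hxi
  · have hs := sin_two_pi_div_ne_zero h3
    have hm0 : (0 : ℝ) < M i j := by
      have : 0 < M i j := by omega
      exact_mod_cast this
    have hm3 : (3 : ℝ) ≤ M i j := by exact_mod_cast h3
    have hc : cos (π / M j i) ≠ 0 := by
      apply ne_of_gt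
      rw [M.symmetric j i]
      apply cos_pos_of_mem_Ioo
      constructor
      · have : 0 < π / M i j := by positivity
        linarith [pi_pos]
      · rw [div_lt_div_iff₀ hm0 two_pos]
        nlinarith [pi_pos]
    have hS := hxj.resolve_right hc
    rw [hS, add_zero, S_two_mul_cos_eq hs, div_eq_one_iff_eq hs, add_mul, one_mul, sin_add] at hxi
    rw [S_two_mul_cos_eq hs, div_eq_zero_iff, or_iff_left hs] at hS
    push_cast at hS hxi
    rw [sub_add_cancel] at hS
    rw [hS, zero_mul, zero_add, mul_eq_right₀ hs, cos_eq_one_iff] at hxi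
    obtain ⟨n, hn⟩ := hxi
    have hn' : (n : ℝ) * M i j = q := by
      field_simp at hn
      nlinarith [pi_pos]
    rw [← Int.natCast_dvd_natCast]
    exact ⟨n, by rw [mul_comm]; exact_mod_cast hn'.symm⟩

end CoxeterMatrix

theorem CoxeterSystem.dvd_of_simple_mul_simple_pow_eq_one {B W : Type*} [Group W]
    {M : CoxeterMatrix B} (cs : CoxeterSystem M W) {i j : B} (hij : i ≠ j) {q : ℕ}
    (h : (cs.simple i * cs.simple j) ^ q = 1) : M i j ∣ q := by
  apply M.dvd_of_geomReflection_pow hij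
  have := congrArg (cs.lift ⟨_, M.isLiftable_geomReflection⟩) h
  rwa [map_pow, map_mul, cs.lift_apply_simple, cs.lift_apply_simple, map_one] at this

/-- The alternating list `[i, j, i, …]` of length `n`. -/
def altList {B : Type*} (i j : B) : ℕ → List B
  | 0 => []
  | n + 1 => i :: altList j i n

theorem length_altList {B : Type*} (i j : B) (n : ℕ) : (altList i j n).length = n := by
  induction n generalizing i j with
  | zero => rfl
  | succ n ih => simp [altList, ih]

theorem take_altList {B : Type*} (i j : B) {k n : ℕ} (h : k ≤ n) :
    (altList i j n).take k = altList i j k := by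
  induction k generalizing i j n with
  | zero => simp [altList]
  | succ k ih =>
    obtain ⟨n, rfl⟩ : ∃ n', n = n' + 1 := ⟨n - 1, by omega⟩
    simp [altList, ih j i (Nat.le_of_succ_le_succ h)]

namespace CoxeterSystem

variable {B W : Type*} [Group W] {M : CoxeterMatrix B} (cs : CoxeterSystem M W)

theorem wordProd_altList_mul_inv (i j : B) (n : ℕ) :
    cs.wordProd (altList i j n) * (cs.wordProd (altList j i n))⁻¹ =
      (cs.simple i * cs.simple j) ^ n := by
  induction n generalizing i j with
  | zero => simp [altList]
  | succ n ih =>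
    rw [altList, altList, cs.wordProd_cons, cs.wordProd_cons, mul_inv_rev, inv_simple, mul_assoc,
      ← mul_assoc (cs.wordProd _), ih j i, pow_succ', mul_assoc, mul_right_inj]
    clear ih
    induction n with
    | zero => simp
    | succ n ih =>
      rw [pow_succ', mul_assoc, ih, pow_succ']
      simp only [mul_assoc]

theorem wordProd_altList_eq_iff (i j : B) (n : ℕ) :
    cs.wordProd (altList i j n) = cs.wordProd (altList j i n) ↔
      (cs.simple i * cs.simple j) ^ n = 1 := by
  rw [← cs.wordProd_altList_mul_inv, mul_inv_eq_one]

/-- Two reduced alternating words of the same element have the length prescribed by the Coxeter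
matrix. -/
theorem eq_of_isReduced_altList {i j : B} (hij : i ≠ j) {q : ℕ} (hq : q ≠ 0)
    (hred : cs.IsReduced (altList i j q))
    (h : cs.wordProd (altList i j q) = cs.wordProd (altList j i q)) : q = M i j := by
  have hdvd := cs.dvd_of_simple_mul_simple_pow_eq_one hij ((cs.wordProd_altList_eq_iff i j q).1 h)
  obtain ⟨n, hn⟩ : ∃ n, M i j = n + 1 :=
    ⟨M i j - 1, by have : M i j ≠ 0 := by rintro h0; simp [h0] at hdvd; exact hq hdvd
                   omega⟩
  apply le_antisymm _ (Nat.le_of_dvd (Nat.pos_of_ne_zero hq) hdvd)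
  by_contra hlt
  have hr := hred.take (n + 2)
  rw [take_altList _ _ (by omega)] at hr
  have hm := (cs.wordProd_altList_eq_iff i j (n + 1)).2 (by
    rw [← hn]; exact cs.simple_mul_simple_pow i j)
  have he : cs.wordProd (altList i j (n + 2)) = cs.wordProd (altList j i n) := by
    rw [altList, cs.wordProd_cons, ← hm, altList, cs.wordProd_cons,
      cs.simple_mul_simple_cancel_left]
  have hle := cs.length_wordProd_le (altList j i n)
  rw [← he, hr.eq, length_altList, length_altList] at hle
  omega

variable {N : Type*} [Monoid N] (φ : B → N)

/-- A pair of reduced words of length `q` for the same element, the first one starting with `i` and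
the second one with `j`, on which the products of `φ` differ. -/
structure BadPair (q : ℕ) (i j : B) (x y : List B) : Prop where
  left : cs.IsReduced x
  right : cs.IsReduced y
  length_left : x.length = q
  length_right : y.length = q
  wordProd_eq : cs.wordProd x = cs.wordProd y
  ne : (x.map φ).prod ≠ (y.map φ).prod
  head_left : x.take 1 = [i]
  head_right : y.take 1 = [j]

variable {φ}

theorem IsReduced.of_cons {i : B} {u : List B} (h : cs.IsReduced (i :: u)) : cs.IsReduced u := by
  simpa using h.drop 1

/-- The last letter of the first word of a bad pair can be traded for a first letter `j`. -/
theorem BadPair.rotate {q : ℕ}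
    (ih : ∀ u v : List B, u.length = q → v.length = q → cs.IsReduced u → cs.IsReduced v →
      cs.wordProd u = cs.wordProd v → (u.map φ).prod = (v.map φ).prod)
    {i j : B} {x y : List B} (h : cs.BadPair φ (q + 1) i j x y) :
    cs.BadPair φ (q + 1) j i (j :: x.dropLast) x := by
  obtain ⟨v, rfl⟩ : ∃ v, y = j :: v := by
    have := h.head_right
    cases y with
    | nil => simp at this
    | cons a v => exact ⟨v, by simp at this; rw [this]⟩
  have hvlen : v.length = q := by simpa using h.length_right
  have hdesc : cs.IsLeftDescent (cs.wordProd x) j := by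
    rw [h.wordProd_eq, IsLeftDescent, h.right.eq, cs.wordProd_cons,
      cs.simple_mul_simple_cancel_left, h.right.of_cons.eq, List.length_cons]
    exact Nat.lt_succ_self _
  obtain ⟨k, hk, hkx⟩ := cs.exists_eraseIdx_of_isLeftDescent hdesc
  have hx' : cs.wordProd (j :: x.eraseIdx k) = cs.wordProd x := by
    rw [cs.wordProd_cons, ← hkx, cs.simple_mul_simple_cancel_left]
  have hxlen : x.length = q + 1 := h.length_left
  have herlen : (x.eraseIdx k).length = q := by
    rw [List.length_eraseIdx_of_lt hk, hxlen]; rfl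
  have hx'red : cs.IsReduced (j :: x.eraseIdx k) := by
    rw [IsReduced, hx', h.left.eq, List.length_cons, herlen, hxlen]
  have hne : (((j :: x.eraseIdx k)).map φ).prod ≠ (x.map φ).prod := by
    intro he
    apply h.ne
    rw [← he, List.map_cons, List.map_cons, List.prod_cons, List.prod_cons]
    congr 1
    apply ih _ _ herlen hvlen hx'red.of_cons h.right.of_cons
    have := hx'.trans h.wordProd_eq
    rwa [cs.wordProd_cons, cs.wordProd_cons, mul_right_inj] at this
  have hkq : k = q := by
    by_contra hkq
    have hklt : k < q := by omega
    apply hne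
    obtain ⟨u, a, rfl⟩ : ∃ u a, x = u ++ [a] := by
      rcases List.eq_nil_or_concat' x with h0 | h0
      · simp [h0] at hxlen
      · exact h0
    have hul : u.length = q := by simpa using hxlen
    rw [List.eraseIdx_append_of_lt_length (by omega)] at hx' hx'red herlen ⊢
    have hl2 : (j :: u.eraseIdx k).length = q := by
      simpa using herlen
    rw [← List.cons_append] at hx' hx'red ⊢
    rw [List.map_append, List.map_append, List.prod_append, List.prod_append]
    congr 1
    rw [cs.wordProd_append, cs.wordProd_append, mul_left_inj] at hx'
    refine ih _ _ hl2 hul ?_ ?_ hx'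
    · have := hx'red.take q
      rwa [List.take_left' hl2] at this
    · have := h.left.take q
      rwa [List.take_left' hul] at this
  have hdl : x.eraseIdx k = x.dropLast := by
    rw [List.dropLast_eq_eraseIdx (i := k) (by omega)]
  rw [hdl] at hx' hx'red hne herlen
  exact ⟨hx'red, h.left, by simpa using herlen, hxlen, hx', hne, by simp, h.head_left⟩

theorem BadPair.exists_altList {q : ℕ}
    (ih : ∀ u v : List B, u.length = q → v.length = q → cs.IsReduced u → cs.IsReduced v →
      cs.wordProd u = cs.wordProd v → (u.map φ).prod = (v.map φ).prod)
    {i j : B} {x y : List B} (h : cs.BadPair φ (q + 1) i j x y) (k : ℕ) (hk : k ≤ q) :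
    ∃ i' j' x' y', cs.BadPair φ (q + 1) i' j' x' y' ∧ x'.take (k + 1) = altList i' j' (k + 1) ∧
      y'.take k = altList j' i' k := by
  induction k with
  | zero => exact ⟨i, j, x, y, h, by simpa [altList] using h.head_left, by simp [altList]⟩
  | succ k ihk =>
    obtain ⟨i', j', x', y', h', hx', hy'⟩ := ihk (by omega)
    refine ⟨j', i', _, _, h'.rotate cs ih, ?_, hx'⟩
    rw [List.take_succ_cons, altList, List.dropLast_eq_take, List.take_take, h'.length_left,
      min_eq_left (by omega), hx']

/-- **Matsumoto's theorem**: a function on the generators satisfying the braid relations takes the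
same product along all reduced words of a given element. -/
theorem prod_map_eq_of_isReduced
    (hφ : ∀ i j, i ≠ j → M i j ≠ 0 →
      ((altList i j (M i j)).map φ).prod = ((altList j i (M i j)).map φ).prod)
    {u v : List B} (hu : cs.IsReduced u) (hv : cs.IsReduced v)
    (h : cs.wordProd u = cs.wordProd v) : (u.map φ).prod = (v.map φ).prod := by
  obtain ⟨q, hq⟩ : ∃ q, u.length = q := ⟨_, rfl⟩
  have hq' : v.length = q := by rw [← hv.eq, ← h, hu.eq, hq]
  induction q generalizing u v with
  | zero => rw [List.eq_nil_of_length_eq_zero hq, List.eq_nil_of_length_eq_zero hq']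
  | succ q ih =>
    have ih' : ∀ u v : List B, u.length = q → v.length = q → cs.IsReduced u → cs.IsReduced v →
      cs.wordProd u = cs.wordProd v → (u.map φ).prod = (v.map φ).prod :=
      fun u v h1 h2 h3 h4 h5 => ih h3 h4 h5 h1 h2
    by_contra hne
    obtain ⟨i, u, rfl⟩ := List.exists_cons_of_length_eq_add_one hq
    obtain ⟨j, v, rfl⟩ := List.exists_cons_of_length_eq_add_one hq'
    have hbad : cs.BadPair φ (q + 1) i j (i :: u) (j :: v) :=
      ⟨hu, hv, hq, hq', h, hne, by simp, by simp⟩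
    obtain ⟨i, j, x, y, h, hx, -⟩ := hbad.exists_altList cs ih' q le_rfl
    rw [List.take_of_length_le h.length_left.le] at hx
    have h2 := h.rotate cs ih'
    have hx2 : j :: x.dropLast = altList j i (q + 1) := by
      rw [hx, List.dropLast_eq_take, length_altList, take_altList _ _ (by omega)]
      rfl
    rw [hx2, hx] at h2
    have hij : j ≠ i := by
      rintro rfl
      exact h2.ne rfl
    have hm := cs.eq_of_isReduced_altList hij q.add_one_ne_zero h2.left h2.wordProd_eq
    apply h2.ne
    rw [hm]
    exact hφ j i hij (by omega)

end CoxeterSystem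

namespace CoxeterSystem

variable {B W : Type*} [Group W] {M : CoxeterMatrix B} (cs : CoxeterSystem M W)

/-- Every reduced word is a suffix of a reduced word for an element of maximal length. -/
theorem exists_mul_wordProd_eq_of_isReduced {w₀ : W} (hw₀ : ∀ w, cs.length w ≤ cs.length w₀)
    {ω : List B} (hω : cs.IsReduced ω) :
    ∃ y, y * cs.wordProd ω = w₀ ∧ cs.length y + ω.length = cs.length w₀ := by
  induction ω using List.reverseRecOn with
  | nil => exact ⟨w₀, by simp, by simp⟩
  | append_singleton ω i ih =>
    have hω' : cs.IsReduced ω := by simpa using hω.take ω.length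
    obtain ⟨y, hy, hyl⟩ := ih hω'
    obtain ⟨η, hη, rfl⟩ := cs.exists_isReduced y
    have hdesc : cs.IsRightDescent (cs.wordProd (η ++ ω)) i := by
      rw [cs.wordProd_append, hy]
      exact lt_of_le_of_ne (hw₀ _) (cs.length_mul_simple_ne _ _)
    obtain ⟨k, hk, hke⟩ := cs.exists_eraseIdx_of_isRightDescent hdesc
    rw [List.length_append] at hk
    rcases lt_or_ge k η.length with hlt | hge
    · rw [List.eraseIdx_append_of_lt_length hlt, cs.wordProd_append, cs.wordProd_append, hy] at hke
      have he : cs.wordProd (η.eraseIdx k) * cs.wordProd (ω ++ [i]) = w₀ := by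
        rw [cs.wordProd_append, ← mul_assoc, ← hke, cs.wordProd_singleton,
          cs.simple_mul_simple_cancel_right]
      refine ⟨_, he, ?_⟩
      have h1 := cs.length_mul_le (cs.wordProd (η.eraseIdx k)) (cs.wordProd (ω ++ [i]))
      have h2 := cs.length_wordProd_le (η.eraseIdx k)
      rw [he, hω.eq] at h1
      rw [List.length_eraseIdx_of_lt hlt] at h2
      rw [hη.eq] at hyl
      rw [List.length_append, List.length_singleton] at h1 ⊢
      omega
    · exfalso
      rw [List.eraseIdx_append_of_length_le hge, cs.wordProd_append, cs.wordProd_append, mul_assoc,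
        mul_right_inj] at hke
      have h1 := cs.length_wordProd_le (ω.eraseIdx (k - η.length))
      rw [← hke, ← cs.wordProd_singleton, ← cs.wordProd_append, hω.eq,
        List.length_eraseIdx_of_lt (by omega), List.length_append] at h1
      omega

theorem exists_mul_eq_of_length_le {w₀ : W} (hw₀ : ∀ w, cs.length w ≤ cs.length w₀) (w : W) :
    ∃ y, y * w = w₀ ∧ cs.length y + cs.length w = cs.length w₀ := by
  obtain ⟨ω, hω, rfl⟩ := cs.exists_isReduced w
  rw [hω.eq]
  exact cs.exists_mul_wordProd_eq_of_isReduced hw₀ hω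

theorem inv_eq_self_of_length_le {w₀ : W} (hw₀ : ∀ w, cs.length w ≤ cs.length w₀) :
    w₀⁻¹ = w₀ := by
  obtain ⟨y, hy, hyl⟩ := cs.exists_mul_eq_of_length_le hw₀ w₀⁻¹
  rw [cs.length_inv, Nat.add_eq_right, cs.length_eq_zero_iff] at hyl
  rwa [hyl, one_mul] at hy

theorem exists_mul_simple_eq_of_length_le {w₀ : W} (hw₀ : ∀ w, cs.length w ≤ cs.length w₀)
    (i : B) : ∃ j, w₀ * cs.simple i = cs.simple j * w₀ := by
  obtain ⟨y, hy, hyl⟩ := cs.exists_mul_eq_of_length_le hw₀ (w₀ * cs.simple i)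
  have hl := (cs.length_mul_simple w₀ i).resolve_left (by have := hw₀ (w₀ * cs.simple i); omega)
  obtain ⟨j, rfl⟩ := cs.length_eq_one_iff.1 (show cs.length y = 1 by omega)
  refine ⟨j, ?_⟩
  nth_rw 2 [← hy]
  rw [cs.simple_mul_simple_cancel_left]

/-- A family indexed by the generators of a finite Coxeter group and satisfying the braid relations
has a central element in the monoid it generates, divisible by all members of the family: the square
of the Garside element. -/
theorem exists_central_of_braid [Finite W] (cs : CoxeterSystem M W) {N : Type*} [Monoid N]
    {φ : B → N}
    (hφ : ∀ i j, i ≠ j → M i j ≠ 0 →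
      ((altList i j (M i j)).map φ).prod = ((altList j i (M i j)).map φ).prod) :
    ∃ D : N, ∀ i, D * φ i = φ i * D ∧ (∃ a, D = φ i * a) ∧ ∃ b, D = b * φ i := by
  obtain ⟨w₀, hw₀⟩ := Finite.exists_max (fun w : W => cs.length w)
  obtain ⟨ω, hω, hwω⟩ := cs.exists_isReduced w₀
  have hφi {i j : B} (h : cs.simple i = cs.simple j) : φ i = φ j := by
    simpa using cs.prod_map_eq_of_isReduced hφ (u := [i]) (v := [j])
      (by simp [IsReduced]) (by simp [IsReduced]) (by simpa using h)
  have hl {i : B} {v : List B} (hv : cs.IsReduced v) (h : cs.simple i * cs.wordProd v = w₀)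
      (hlen : v.length + 1 = cs.length w₀) : (ω.map φ).prod = φ i * (v.map φ).prod := by
    rw [← List.prod_cons, ← List.map_cons]
    refine cs.prod_map_eq_of_isReduced hφ hω ?_ ?_
    · rw [IsReduced, cs.wordProd_cons, h, List.length_cons, hlen]
    · rw [cs.wordProd_cons, h, hwω]
  have hr {i : B} {v : List B} (hv : cs.IsReduced v) (h : cs.wordProd v * cs.simple i = w₀)
      (hlen : v.length + 1 = cs.length w₀) : (ω.map φ).prod = (v.map φ).prod * φ i := by
    have := cs.prod_map_eq_of_isReduced hφ hω (v := v ++ [i]) ?_ ?_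
    · simpa using this
    · rw [IsReduced, cs.wordProd_append, cs.wordProd_singleton, h, List.length_append,
        List.length_singleton, hlen]
    · rw [cs.wordProd_append, cs.wordProd_singleton, h, hwω]
  have key (i : B) : ∃ (j : B) (v : List B), w₀ * cs.simple i = cs.simple j * w₀ ∧
      (ω.map φ).prod = (v.map φ).prod * φ i ∧ (ω.map φ).prod = φ j * (v.map φ).prod := by
    obtain ⟨j, hj⟩ := cs.exists_mul_simple_eq_of_length_le hw₀ i
    obtain ⟨v, hv, hve⟩ := cs.exists_isReduced (w₀ * cs.simple i)
    have hlen := (cs.length_mul_simple w₀ i).resolve_left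
      (by have := hw₀ (w₀ * cs.simple i); omega)
    rw [hve, hv.eq] at hlen
    refine ⟨j, v, hj, hr hv ?_ hlen, hl hv ?_ hlen⟩
    · rw [← hve, cs.simple_mul_simple_cancel_right]
    · rw [← hve, hj, cs.simple_mul_simple_cancel_left]
  refine ⟨(ω.map φ).prod * (ω.map φ).prod, fun i => ?_⟩
  obtain ⟨j, v, hj, hv1, hv2⟩ := key i
  obtain ⟨k, u, hk, hu1, hu2⟩ := key j
  have hki : cs.simple k = cs.simple i := by
    have hinv := cs.inv_eq_self_of_length_le hw₀
    have h1 : cs.simple k = w₀ * cs.simple j * w₀⁻¹ := by rw [hk]; group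
    have h2 : cs.simple i = w₀⁻¹ * cs.simple j * w₀ := by rw [mul_assoc, ← hj]; group
    rw [h1, h2, hinv]
  have hki' := hφi hki
  have e1 : (ω.map φ).prod * φ i = φ j * (ω.map φ).prod := by
    rw [hv2, mul_assoc, ← hv1, hv2]
  have e2 : (ω.map φ).prod * φ j = φ i * (ω.map φ).prod := by
    rw [hu2, mul_assoc, ← hu1, hu2, hki']
  refine ⟨by rw [mul_assoc, e1, ← mul_assoc, e2, mul_assoc], ⟨(u.map φ).prod * (ω.map φ).prod, ?_⟩,
    ⟨(ω.map φ).prod * (v.map φ).prod, ?_⟩⟩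
  · nth_rw 1 [hu2]
    rw [hki', mul_assoc]
  · nth_rw 2 [hv1]
    rw [mul_assoc]

end CoxeterSystem

/-- The powers of a central element form an Ore set. -/
@[reducible] def oreSetPowersOfCentral {N : Type*} [Monoid N] (D : N) (hD : ∀ x, D * x = x * D) :
    OreLocalization.OreSet (Submonoid.powers D) where
  ore_right_cancel r₁ r₂ s h := by
    obtain ⟨_, n, rfl⟩ := s
    refine ⟨⟨_, n, rfl⟩, ?_⟩
    have hc (x : N) : Commute (D ^ n) x := Commute.pow_left (hD x) n
    simpa only [(hc _).eq] using h
  oreNum r _ := r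
  oreDenom _ s := s
  ore_eq r s := by
    obtain ⟨_, n, rfl⟩ := s
    exact Commute.pow_left (hD r) n

/-- If the members of a family in a left cancellative monoid divide a central element on both
sides, then the products of this family satisfy the same relations as those of a family in some
group. -/
theorem exists_group_prod_eq_iff.{u, v} {N : Type u} [Monoid N] [IsLeftCancelMul N] {ι : Type v}
    {φ : ι → N} {D : N} (hD : ∀ x, D * x = x * D) (hl : ∀ i, ∃ a, D = φ i * a)
    (hr : ∀ i, ∃ b, D = b * φ i) :
    ∃ (G : Type u) (_ : Group G) (ψ : ι → G), ∀ l l' : List ι,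
      (l.map ψ).prod = (l'.map ψ).prod ↔ (l.map φ).prod = (l'.map φ).prod := by
  let _ := oreSetPowersOfCentral D hD
  let κ : N →* OreLocalization (Submonoid.powers D) N := OreLocalization.numeratorHom
  have hDu : IsUnit (κ D) := OreLocalization.numerator_isUnit ⟨D, Submonoid.mem_powers D⟩
  have hu (i : ι) : IsUnit (κ (φ i)) := by
    obtain ⟨a, ha⟩ := hl i
    obtain ⟨b, hb⟩ := hr i
    obtain ⟨u, hu⟩ := hDu
    have h1 : κ (φ i) * (κ a * ↑u⁻¹) = 1 := by
      rw [← mul_assoc, ← map_mul, ← ha, ← hu, Units.mul_inv]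
    have h2 : (↑u⁻¹ * κ b) * κ (φ i) = 1 := by
      rw [mul_assoc, ← map_mul, ← hb, ← hu, Units.inv_mul]
    exact isUnit_iff_exists.2 ⟨_, h1, by rwa [← left_inv_eq_right_inv h2 h1]⟩
  choose ψ hψ using hu
  have hκ (l : List ι) : ((l.map ψ).prod : OreLocalization (Submonoid.powers D) N) =
      κ (l.map φ).prod := by
    induction l with
    | nil => simp
    | cons i l ih => simp [hψ, ih]
  refine ⟨(OreLocalization (Submonoid.powers D) N)ˣ, inferInstance, ψ, fun l l' => ?_⟩
  rw [← Units.val_inj, hκ, hκ]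
  refine ⟨fun h => ?_, fun h => by rw [h]⟩
  obtain ⟨u, v, h1, h2⟩ := OreLocalization.oreDiv_eq_iff.1 h
  simp only [OneMemClass.coe_one, mul_one, Submonoid.smul_def, smul_eq_mul] at h1 h2
  rw [← h2] at h1
  exact (mul_left_cancel h1).symm

theorem altOp_eq_prod_map_altList {E : Type*} [NormedAddCommGroup E] [InnerProductSpace ℂ E]
    [CompleteSpace E] (Vs : Λ → (E →L[ℂ] E)) (s t : Λ) (n : ℕ) :
    altOp Vs s t n = ((altList s t n).map Vs).prod := by
  induction n generalizing s t with
  | zero => rfl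
  | succ n ih => simp [altOp, altList, ih]

theorem lift_altWord {G : Type*} [Group G] (f : Λ → G) (s t : Λ) (n : ℕ) :
    FreeGroup.lift f (altWord s t n) = ((altList s t n).map f).prod := by
  induction n generalizing s t with
  | zero => simp [altWord, altList]
  | succ n ih => simp [altWord, altList, ih]

/-- The generator `s` of the Artin group. -/
def ArtinGroup.of (M : Λ → Λ → ℕ∞) (s : Λ) : ArtinGroup M := PresentedGroup.of s

/-- The Coxeter matrix of `M` in the convention where `0` stands for `∞`. -/
def IsCoxeterMatrix.toCoxeterMatrix {M : Λ → Λ → ℕ∞} (hM : IsCoxeterMatrix M) :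
    CoxeterMatrix Λ where
  M := Matrix.of fun s t => (M s t).toNat
  isSymm := by
    ext s t
    simp [hM.1 s t]
  diagonal s := by simp [hM.2.1 s]
  off_diagonal s t hst h := by
    have h1 := hM.2.2 s t hst
    have h2 : M s t = 1 := by
      rw [Matrix.of_apply] at h
      exact (ENat.toNat_eq_iff one_ne_zero).1 h
    rw [h2] at h1
    exact absurd h1 (by decide)

theorem IsCoxeterMatrix.toCoxeterMatrix_apply {M : Λ → Λ → ℕ∞} (hM : IsCoxeterMatrix M) (s t : Λ) :
    hM.toCoxeterMatrix s t = (M s t).toNat := rfl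

theorem IsCoxeterMatrix.finite_group {M : Λ → Λ → ℕ∞} (hM : IsCoxeterMatrix M)
    [Finite (CoxeterGroupOf M)] : Finite hM.toCoxeterMatrix.Group := by
  let cs := hM.toCoxeterMatrix.toCoxeterSystem
  let f : CoxeterGroupOf M →* hM.toCoxeterMatrix.Group :=
    PresentedGroup.toGroup (f := cs.simple) (by
      rintro r (⟨s, t, m, hst, hm, rfl⟩ | ⟨s, rfl⟩)
      · rw [map_mul, map_inv, lift_altWord, lift_altWord, mul_inv_eq_one]
        refine (cs.wordProd_altList_eq_iff s t m).2 ?_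
        have := cs.simple_mul_simple_pow s t
        rwa [hM.toCoxeterMatrix_apply, hm, ENat.toNat_natCast] at this
      · simp)
  have hf : Function.Surjective f := by
    rw [← MonoidHom.range_eq_top, eq_top_iff, ← cs.subgroup_closure_range_simple,
      Subgroup.closure_le]
    rintro _ ⟨s, rfl⟩
    exact ⟨PresentedGroup.of s, PresentedGroup.toGroup.of _⟩
  exact Finite.of_surjective f hf

/-- A generating family of a left cancellative monoid satisfying the braid relations of a Coxeter
matrix of finite type satisfies all relations between positive words that hold in the Artin
group. -/
theorem prod_map_eq_of_artinGroup {M : Λ → Λ → ℕ∞} (hM : IsCoxeterMatrix M)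
    [Finite (CoxeterGroupOf M)] {N : Type*} [Monoid N] [IsLeftCancelMul N] {φ : Λ → N}
    (hgen : Submonoid.closure (Set.range φ) = ⊤)
    (hφ : ∀ (s t : Λ) (m : ℕ), s ≠ t → M s t = (m : ℕ∞) →
      ((altList s t m).map φ).prod = ((altList t s m).map φ).prod) {l l' : List Λ}
    (h : (l.map (ArtinGroup.of M)).prod =
      (l'.map (ArtinGroup.of M)).prod) :
    (l.map φ).prod = (l'.map φ).prod := by
  have := hM.finite_group
  obtain ⟨D, hD⟩ := CoxeterSystem.exists_central_of_braid hM.toCoxeterMatrix.toCoxeterSystem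
    (φ := φ) (fun s t hst h0 => by
      apply hφ s t _ hst
      rw [hM.toCoxeterMatrix_apply] at h0 ⊢
      exact (ENat.natCast_toNat fun h => h0 (by simp [h])).symm)
  have hc (x : N) : D * x = x * D := by
    have hx : x ∈ Submonoid.closure (Set.range φ) := hgen ▸ Submonoid.mem_top x
    induction hx using Submonoid.closure_induction with
    | mem x hx =>
      obtain ⟨s, rfl⟩ := hx
      exact (hD s).1
    | one => simp
    | mul x y _ _ hx hy => rw [← mul_assoc, hx, mul_assoc, hy, mul_assoc]
  obtain ⟨G, _, ψ, hψ⟩ := exists_group_prod_eq_iff hc (fun i => (hD i).2.1) (fun i => (hD i).2.2)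
  let f : ArtinGroup M →* G := PresentedGroup.toGroup (f := ψ) (by
    rintro r ⟨s, t, m, hst, hm, rfl⟩
    rw [map_mul, map_inv, lift_altWord, lift_altWord, mul_inv_eq_one, hψ]
    exact hφ s t m hst hm)
  have hf (s : Λ) : f (ArtinGroup.of M s) = ψ s := PresentedGroup.toGroup.of _
  rw [← hψ]
  have := congrArg f h
  rw [map_list_prod, map_list_prod, List.map_map, List.map_map] at this
  simpa only [Function.comp_def, hf] using this

section Extension

variable {E : Type*} [NormedAddCommGroup E] [InnerProductSpace ℂ E] [CompleteSpace E]

/-- The monoid of isometries of a Hilbert space. -/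
def isometrySubmonoid (E : Type*) [NormedAddCommGroup E] [InnerProductSpace ℂ E]
    [CompleteSpace E] : Submonoid (E →L[ℂ] E) where
  carrier := {T | ContinuousLinearMap.adjoint T * T = 1}
  one_mem' := by simp [← ContinuousLinearMap.star_eq_adjoint]
  mul_mem' {S T} hS hT := by
    simp only [Set.mem_ofPred_eq, ← ContinuousLinearMap.star_eq_adjoint, star_mul] at *
    rw [mul_assoc, ← mul_assoc _ S, hS, one_mul, hT]

theorem prod_map_eq_of_isometries {M : Λ → Λ → ℕ∞} (hM : IsCoxeterMatrix M)
    [Finite (CoxeterGroupOf M)] {Vs : Λ → (E →L[ℂ] E)}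
    (hiso : ∀ s : Λ, ContinuousLinearMap.adjoint (Vs s) * Vs s = 1)
    (hartin : ∀ (s t : Λ) (m : ℕ), s ≠ t → M s t = (m : ℕ∞) →
      altOp Vs s t m = altOp Vs t s m) {l l' : List Λ}
    (h : (l.map (ArtinGroup.of M)).prod =
      (l'.map (ArtinGroup.of M)).prod) :
    (l.map Vs).prod = (l'.map Vs).prod := by
  have hle : Submonoid.closure (Set.range Vs) ≤ isometrySubmonoid E := by
    rw [Submonoid.closure_le]
    rintro _ ⟨s, rfl⟩
    exact hiso s
  let φ (s : Λ) : Submonoid.closure (Set.range Vs) := ⟨Vs s, Submonoid.subset_closure ⟨s, rfl⟩⟩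
  have hcoe (l : List Λ) : ((l.map φ).prod : E →L[ℂ] E) = (l.map Vs).prod := by
    simp [φ, Function.comp_def]
  have : IsLeftCancelMul (Submonoid.closure (Set.range Vs)) := ⟨by
    intro S T T' h
    have hS : ContinuousLinearMap.adjoint (S : E →L[ℂ] E) * S = 1 := hle S.2
    have h' : (S : E →L[ℂ] E) * T = S * T' := congrArg Subtype.val h
    rw [Subtype.ext_iff, ← one_mul (T : E →L[ℂ] E), ← hS, mul_assoc, h', ← mul_assoc, hS, one_mul]⟩
  have hgen : Submonoid.closure (Set.range φ) = ⊤ := by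
    have := Submonoid.closure_closure_coe_preimage (s := Set.range Vs)
    convert this using 2
    ext x
    simp [φ, Subtype.ext_iff]
  rw [← hcoe, ← hcoe, prod_map_eq_of_artinGroup hM hgen _ h]
  intro s t m hst hm
  rw [Subtype.ext_iff, hcoe, hcoe, ← altOp_eq_prod_map_altList, ← altOp_eq_prod_map_altList]
  exact hartin s t m hst hm

/-- Isometries satisfying the Artin relations of a Coxeter matrix of finite type extend to an
isometric representation of the Artin monoid. -/
theorem exists_isIsomRep_of_altOp_eq {M : Λ → Λ → ℕ∞} (hM : IsCoxeterMatrix M)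
    [Finite (CoxeterGroupOf M)] {Vs : Λ → (E →L[ℂ] E)}
    (hiso : ∀ s : Λ, ContinuousLinearMap.adjoint (Vs s) * Vs s = 1)
    (hartin : ∀ (s t : Λ) (m : ℕ), s ≠ t → M s t = (m : ℕ∞) →
      altOp Vs s t m = altOp Vs t s m) :
    ∃ W : artinCone M → (E →L[ℂ] E), IsIsomRep (artinCone M) W ∧
      ∀ s : Λ, W (artinGen M s) = Vs s := by
  have hex (x : artinCone M) : ∃ l : List Λ,
      (l.map (ArtinGroup.of M)).prod = x := by
    obtain ⟨x, hx⟩ := x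
    induction hx using Submonoid.closure_induction with
    | mem x hx =>
      obtain ⟨s, rfl⟩ := hx
      exact ⟨[s], List.prod_singleton⟩
    | one => exact ⟨[], by simp⟩
    | mul x y _ _ hx hy =>
      obtain ⟨l, hl⟩ := hx
      obtain ⟨l', hl'⟩ := hy
      exact ⟨l ++ l', by simp only [List.map_append, List.prod_append, hl, hl']⟩
  choose word hword using hex
  have hW {x : artinCone M} {l : List Λ}
      (h : (l.map (ArtinGroup.of M)).prod = x) :
      ((word x).map Vs).prod = (l.map Vs).prod :=
    prod_map_eq_of_isometries hM hiso hartin ((hword x).trans h.symm)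
  refine ⟨fun x => ((word x).map Vs).prod, ⟨?_, fun x y => ?_, fun x => ?_⟩, fun s => ?_⟩
  · exact hW (l := []) (by simp)
  · rw [← List.prod_append, ← List.map_append]
    exact hW (by simp only [List.map_append, List.prod_append, hword, Submonoid.coe_mul])
  · have : ((word x).map Vs).prod ∈ isometrySubmonoid E := by
      apply Submonoid.list_prod_mem
      intro T hT
      obtain ⟨s, -, rfl⟩ := List.mem_map.1 hT
      exact hiso s
    exact this
  · simpa using hW (x := artinGen M s) (l := [s]) List.prod_singleton

end Extension

section Covariance

variable {G : Type*} [Group G] {P : Submonoid G}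

theorem lle_iff_exists {x y : G} : lle P x y ↔ ∃ c : P, x * c = y :=
  ⟨fun h => ⟨⟨_, h⟩, mul_inv_cancel_left x y⟩, by rintro ⟨c, rfl⟩; simp [lle]⟩

theorem lle_mul (x : G) (c : P) : lle P x (x * c) := lle_iff_exists.2 ⟨c, rfl⟩

theorem lle.trans {x y z : G} (h : lle P x y) (h' : lle P y z) : lle P x z := by
  obtain ⟨c, rfl⟩ := lle_iff_exists.1 h
  obtain ⟨d, rfl⟩ := lle_iff_exists.1 h'
  exact lle_iff_exists.2 ⟨c * d, by simp [mul_assoc]⟩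

theorem lle_mul_left_iff {x y : G} (g : G) : lle P (g * x) y ↔ lle P x (g⁻¹ * y) := by
  simp [lle, mul_assoc]

theorem IsPoGroup.lle_antisymm (hpo : IsPoGroup P) {x y : G} (h : lle P x y) (h' : lle P y x) :
    x = y :=
  inv_mul_eq_one.1 (hpo _ h (by simpa [lle] using h'))

theorem exists_isLub'_mul (hlat : ∀ x y : G, ∃ m, IsLub' P x y m) (x y : P) :
    ∃ c d : P, x * c = y * d ∧ IsLub' P (x : G) y ↑(x * c) := by
  obtain ⟨m, hm⟩ := hlat x y
  obtain ⟨c, hc⟩ := lle_iff_exists.1 hm.1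
  obtain ⟨d, hd⟩ := lle_iff_exists.1 hm.2.1
  exact ⟨c, d, Subtype.ext (by simp [hc, hd]), by rwa [Submonoid.coe_mul, hc]⟩

variable {E : Type*} [NormedAddCommGroup E] [InnerProductSpace ℂ E] [CompleteSpace E]

/-- In a lattice ordered group with a length function, the covariance relation for an isometric
representation follows from its instances for the generators. -/
theorem IsIsomRep.star_mul_eq {W : P → (E →L[ℂ] E)} (hW : IsIsomRep P W) (hpo : IsPoGroup P)
    (hlat : ∀ x y : G, ∃ m, IsLub' P x y m) (S : Set P) (len : G →* Multiplicative ℤ)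
    (hS : ∀ x : P, x = 1 ∨ ∃ s ∈ S, ∃ x', x = s * x') (hlen : ∀ x : P, 1 ≤ len x)
    (hlenS : ∀ s ∈ S, len s = Multiplicative.ofAdd 1)
    (hcov : ∀ s ∈ S, ∀ t ∈ S, ∀ m : P, IsLub' P (s : G) t m →
      W s * star (W s) * (W t * star (W t)) = W m * star (W m))
    (n : ℕ) (x y c d : P) (hxy : x * c = y * d) (hlub : IsLub' P (x : G) y ↑(x * c))
    (hn : len ↑(x * c) < Multiplicative.ofAdd (n : ℤ)) :
    star (W x) * W y = W c * star (W d) := by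
  obtain ⟨hW1, hWmul, hWiso⟩ := hW
  simp only [← ContinuousLinearMap.star_eq_adjoint] at hWiso
  have hinv {u : P} (h : lle P (u : G) 1) : u = 1 :=
    Subtype.ext (hpo _ u.2 (by simpa [lle] using h))
  induction n generalizing x y c d with
  | zero => exact absurd hn (hlen _).not_gt
  | succ n ih =>
    rcases hS x with rfl | ⟨s, hs, x', rfl⟩
    · have hd : d = 1 := hinv (by
        have := hlub.2.2 y (by simp [lle]) (by simp [lle])
        rwa [hxy, Submonoid.coe_mul, lle_mul_left_iff, inv_mul_cancel] at this)
      rw [one_mul, hd, mul_one] at hxy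
      simp [hW1, hd, hxy]
    rcases hS y with rfl | ⟨t, ht, y', rfl⟩
    · have hc : c = 1 := hinv (by
        have := hlub.2.2 (s * x' : P) (by simp [lle]) (by simpa [lle] using (s * x').2)
        rwa [Submonoid.coe_mul, lle_mul_left_iff, inv_mul_cancel] at this)
      rw [one_mul, hc, mul_one] at hxy
      simp [hW1, hc, hxy]
    obtain ⟨z, hz⟩ : ∃ z : G, ↑(s * x' * c) = z := ⟨_, rfl⟩
    rw [hz] at hlub hn
    obtain ⟨hxz, hyz, hlub⟩ := hlub
    obtain ⟨a, b, hab, hm⟩ := exists_isLub'_mul hlat s t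
    have hst : star (W s) * W t = W a * star (W b) := by
      have h := hcov s hs t ht _ hm
      have h2 : star (W s) * (W s * star (W s) * (W t * star (W t))) * W t =
          star (W s) * (W (s * a) * star (W (t * b))) * W t := by
        rw [h, ← hab]
      simp only [hWmul, star_mul] at h2
      calc star (W s) * W t
          = (star (W s) * W s) * star (W s) * W t * (star (W t) * W t) := by
            rw [hWiso, hWiso, one_mul, mul_one]
        _ = star (W s) * (W s * star (W s) * (W t * star (W t))) * W t := by
            simp only [mul_assoc]
        _ = (star (W s) * W s) * (W a * star (W b)) * (star (W t) * W t) := by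
            rw [h2]
            simp only [mul_assoc]
        _ = W a * star (W b) := by rw [hWiso, hWiso, one_mul, mul_one]
    have hmz : lle P ↑(s * a) z := hm.2.2 z
      (lle.trans (by rw [Submonoid.coe_mul]; exact lle_mul _ _) hxz)
      (lle.trans (by rw [Submonoid.coe_mul]; exact lle_mul _ _) hyz)
    have hle {g u : P} (hg : Multiplicative.ofAdd 1 ≤ len g) (h : lle P ↑u ((g : G)⁻¹ * z)) :
        len u < Multiplicative.ofAdd (n : ℤ) := by
      obtain ⟨v, hv⟩ := lle_iff_exists.1 h
      have h1 : len g * (len u * len v) = len z := by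
        rw [← map_mul, ← map_mul, hv, mul_inv_cancel_left]
      have h2 := hlen v
      rw [← h1] at hn
      rw [← Multiplicative.toAdd_le] at hg h2
      rw [← Multiplicative.toAdd_lt] at hn ⊢
      simp only [toAdd_mul, toAdd_ofAdd, toAdd_one] at hg hn h2 ⊢
      push_cast at hn
      omega
    obtain ⟨c₁, d₁, h₁, hm₁⟩ := exists_isLub'_mul hlat x' a
    obtain ⟨e, f, h₂, hm₂⟩ := exists_isLub'_mul hlat b y'
    obtain ⟨p, q, h₃, hm₃⟩ := exists_isLub'_mul hlat d₁ e
    have hz₁ : lle P ↑(x' * c₁) ((s : G)⁻¹ * z) := hm₁.2.2 _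
      (by rwa [← lle_mul_left_iff, ← Submonoid.coe_mul])
      (by rwa [← lle_mul_left_iff, ← Submonoid.coe_mul])
    have hz₂ : lle P ↑(b * e) ((t : G)⁻¹ * z) := hm₂.2.2 _
      (by rwa [← lle_mul_left_iff, ← Submonoid.coe_mul, ← hab])
      (by rwa [← lle_mul_left_iff, ← Submonoid.coe_mul])
    have hz₃ : lle P ↑(d₁ * p) (((s * a : P) : G)⁻¹ * z) := hm₃.2.2 _
      (by rwa [← lle_mul_left_iff, ← Submonoid.coe_mul, mul_assoc, ← h₁, Submonoid.coe_mul,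
        lle_mul_left_iff])
      (by rwa [← lle_mul_left_iff, ← Submonoid.coe_mul, hab, mul_assoc, Submonoid.coe_mul,
        lle_mul_left_iff])
    have e₁ := ih _ _ _ _ h₁ hm₁ (hle (hlenS s hs).ge hz₁)
    have e₂ := ih _ _ _ _ h₂ hm₂ (hle (hlenS t ht).ge hz₂)
    have e₃ := ih _ _ _ _ h₃ hm₃ (hle (by
      rw [Submonoid.coe_mul, map_mul, hlenS s hs]
      exact le_mul_of_one_le_right' (hlen a)) hz₃)
    have hx3 : s * x' * (c₁ * p) = s * a * (d₁ * p) := by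
      rw [mul_assoc, ← mul_assoc x', h₁]
      simp only [mul_assoc]
    have hy3 : t * y' * (f * q) = s * a * (d₁ * p) := by
      rw [mul_assoc, ← mul_assoc y', ← h₂, hab, h₃]
      simp only [mul_assoc]
    have hzeq : s * a * (d₁ * p) = s * x' * c := Subtype.ext (by
      rw [hz]
      refine hpo.lle_antisymm ?_ (hlub _ ?_ ?_)
      · rwa [Submonoid.coe_mul, lle_mul_left_iff]
      · rw [← hx3, Submonoid.coe_mul]
        exact lle_mul _ _
      · rw [← hy3, Submonoid.coe_mul]
        exact lle_mul _ _)
    have hc : c₁ * p = c := mul_left_cancel (hx3.trans hzeq)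
    have hd : f * q = d := mul_left_cancel (hy3.trans (hzeq.trans hxy))
    calc star (W (s * x')) * W (t * y')
        = star (W x') * (star (W s) * W t) * W y' := by
          simp only [hWmul, star_mul, mul_assoc]
      _ = (star (W x') * W a) * (star (W b) * W y') := by
          rw [hst]
          simp only [mul_assoc]
      _ = W c₁ * (star (W d₁) * W e) * star (W f) := by
          rw [e₁, e₂]
          simp only [mul_assoc]
      _ = W c * star (W d) := by
          rw [e₃, ← hc, ← hd]
          simp only [hWmul, star_mul, mul_assoc]

end Covariance

/-- The homomorphism from an Artin group to the integers sending every generator to `1`. -/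
def ArtinGroup.lengthHom (M : Λ → Λ → ℕ∞) : ArtinGroup M →* Multiplicative ℤ :=
  PresentedGroup.toGroup (f := fun _ => Multiplicative.ofAdd 1) (by
    rintro r ⟨s, t, m, -, -, rfl⟩
    rw [map_mul, map_inv, lift_altWord, lift_altWord, mul_inv_eq_one]
    simp [length_altList])

theorem ArtinGroup.lengthHom_artinGen (M : Λ → Λ → ℕ∞) (s : Λ) :
    ArtinGroup.lengthHom M (artinGen M s) = Multiplicative.ofAdd 1 :=
  PresentedGroup.toGroup.of _

theorem artinCone_induction {M : Λ → Λ → ℕ∞} {p : artinCone M → Prop} (one : p 1)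
    (gen_mul : ∀ s x, p x → p (artinGen M s * x)) (x : artinCone M) : p x := by
  obtain ⟨x, hx⟩ := x
  induction hx using Submonoid.closure_induction_left with
  | one => exact one
  | mul_left s hs x hx ih =>
    obtain ⟨s, rfl⟩ := hs
    exact gen_mul s ⟨x, hx⟩ ih

/-- For an isometric representation of the positive cone of an Artin group which is a lattice
ordered group, covariance on the generators implies covariance. -/
theorem IsIsomRep.isCovariantRep_of_artinGen {E : Type*} [NormedAddCommGroup E]
    [InnerProductSpace ℂ E] [CompleteSpace E] {M : Λ → Λ → ℕ∞} {W : artinCone M → (E →L[ℂ] E)}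
    (hW : IsIsomRep (artinCone M) W) (hpo : IsPoGroup (artinCone M))
    (hlat : ∀ x y : ArtinGroup M, ∃ m, IsLub' (artinCone M) x y m)
    (hcov : ∀ (s t : Λ) (m : artinCone M),
      IsLub' (artinCone M) (artinGen M s : ArtinGroup M) (artinGen M t) m →
      W (artinGen M s) * ContinuousLinearMap.adjoint (W (artinGen M s)) *
        (W (artinGen M t) * ContinuousLinearMap.adjoint (W (artinGen M t))) =
        W m * ContinuousLinearMap.adjoint (W m)) :
    IsCovariantRep (artinCone M) W := by
  intro x y
  refine ⟨fun h => ?_, fun m hm => ?_⟩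
  · obtain ⟨m, hm⟩ := hlat x y
    exact absurd ⟨m, hm.1, hm.2.1⟩ h
  obtain ⟨c, hc⟩ := lle_iff_exists.1 hm.1
  obtain ⟨d, hd⟩ := lle_iff_exists.1 hm.2.1
  obtain rfl : m = x * c := Subtype.ext hc.symm
  have hxy : x * c = y * d := Subtype.ext hd.symm
  have hlen (x : artinCone M) : 1 ≤ ArtinGroup.lengthHom M x := by
    induction x using artinCone_induction with
    | one => simp
    | gen_mul s x ih =>
      rw [Submonoid.coe_mul, map_mul, ArtinGroup.lengthHom_artinGen]
      exact one_le_mul (by decide) ih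
  have key := hW.star_mul_eq hpo hlat (Set.range (artinGen M)) (ArtinGroup.lengthHom M)
    (fun x => by
      induction x using artinCone_induction with
      | one => exact Or.inl rfl
      | gen_mul s x _ => exact Or.inr ⟨_, ⟨s, rfl⟩, x, rfl⟩)
    hlen (by rintro _ ⟨s, rfl⟩; exact ArtinGroup.lengthHom_artinGen M s)
    (by rintro _ ⟨s, rfl⟩ _ ⟨t, rfl⟩ m hm; exact hcov s t m hm)
    ((ArtinGroup.lengthHom M ↑(x * c)).toAdd.toNat + 1) x y c d hxy hm (by
      rw [← Multiplicative.toAdd_lt, toAdd_ofAdd]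
      push_cast
      exact Int.lt_add_one_of_le (Int.self_le_toNat _))
  simp only [← ContinuousLinearMap.star_eq_adjoint]
  calc W x * star (W x) * (W y * star (W y))
      = W x * (star (W x) * W y) * star (W y) := by simp only [mul_assoc]
    _ = W (x * c) * star (W (y * d)) := by
      rw [key, hW.2.1, hW.2.1, star_mul]
      simp only [mul_assoc]
    _ = W (x * c) * star (W (x * c)) := by rw [hxy]

/-- part of Theorem 6.6. Let `A_M` be an Artin group of finite type
(the associated Coxeter group is finite), so that `(A_M, A_M^+)` is a lattice ordered
group.  If `{V_s}` is a collection of isometries on a Hilbert space satisfying the Artin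
relations `⟨V_s V_t⟩^{m_{s,t}} = ⟨V_t V_s⟩^{m_{s,t}}`, then `s ↦ V_s` extends to an
isometric representation `W` of `A_M^+`; and if moreover
`V_s V_s^* V_t V_t^* = V_{s∨t} V_{s∨t}^*` for all generators `s, t`, then `W` is a
covariant isometric representation of `A_M^+`. -/
theorem artin_isometries_extend_and_covariant
    {E : Type*} [NormedAddCommGroup E] [InnerProductSpace ℂ E] [CompleteSpace E]
    [Finite Λ] (M : Λ → Λ → ℕ∞) (hM : IsCoxeterMatrix M)
    (hfin : Finite (CoxeterGroupOf M))
    (hpo : IsPoGroup (artinCone M))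
    (hlat : ∀ x y : ArtinGroup M, ∃ m, IsLub' (artinCone M) x y m)
    (Vs : Λ → (E →L[ℂ] E))
    (hiso : ∀ s : Λ, ContinuousLinearMap.adjoint (Vs s) * Vs s = 1)
    (hartin : ∀ (s t : Λ) (m : ℕ), s ≠ t → M s t = (m : ℕ∞) →
      altOp Vs s t m = altOp Vs t s m) :
    ∃ W : ↥(artinCone M) → (E →L[ℂ] E),
      IsIsomRep (artinCone M) W ∧
      (∀ s : Λ, W (artinGen M s) = Vs s) ∧
      ((∀ (s t : Λ) (m : ↥(artinCone M)),
          IsLub' (artinCone M) (PresentedGroup.of s) (PresentedGroup.of t) (m : ArtinGroup M) →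
          Vs s * ContinuousLinearMap.adjoint (Vs s) *
            (Vs t * ContinuousLinearMap.adjoint (Vs t)) =
            W m * ContinuousLinearMap.adjoint (W m)) →
        IsCovariantRep (artinCone M) W) := by
  obtain ⟨W, hW, hWs⟩ := exists_isIsomRep_of_altOp_eq hM hiso hartin
  refine ⟨W, hW, hWs, fun hcov => hW.isCovariantRep_of_artinGen hpo hlat fun s t m hm => ?_⟩
  rw [hWs, hWs]
  exact hcov s t m hm
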